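/- Let Γ be the graph of a faithful transitive right action of a group G generated by a finite symmetric set S, satisfying conditions (1) and (2). Then there exists a constant C_1, depending only on Γ, such that for every word w ∈ S*, all exponents 1 ≤ p_1 < p_2, and every real V > 0, one has N_{p_1}(w)^{p_1} ≤ C_1·V^{p_1} + V^{p_1−p_2}·N_{p_2}(w)^{p_2}. -/

import Mathlib

noncomputable section

namespace ActionGrowth

variable {G V : Type} [Group G]

/-- The product in `G` of a word over the generating set `S`. -/
def wordProd (S : Set G) (w : List S) : G := (w.map (fun s => (s : G))).prod

/-- The (vertex set of the) ball of radius `R` centered at `v` in the graph of the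
right action `act` of `G` on `V` with respect to the symmetric generating set `S`. -/
def ball (act : V → G → V) (S : Set G) (v : V) (R : ℕ) : Set V :=
  {u | ∃ w : List S, w.length ≤ R ∧ act v (wordProd S w) = u}

/-- Graph distance in the graph of the action (for a symmetric generating set `S`). -/
def gdist (act : V → G → V) (S : Set G) (v u : V) : ℕ :=
  sInf {n | u ∈ ball act S v n}

/-- `R_w(v)`: the maximum over the prefixes `s₁ ⋯ s_i` of `w` of the distances
`d(v, v · s₁ ⋯ s_i)`, i.e. the minimal radius of a ball centered at `v`
containing the path labeled `w` starting at `v`. -/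
def rad (act : V → G → V) (S : Set G) (w : List S) (v : V) : ℕ :=
  (Finset.range (w.length + 1)).sup fun i => gdist act S v (act v (wordProd S (w.take i)))

/-- Isomorphism of the rooted labeled balls `(B_v(R), v)` and `(B_u(R), u)`:
a bijection of the balls sending root to root and preserving the labeled edges
of the spanned subgraphs. -/
def BallIso (act : V → G → V) (S : Set G) (R : ℕ) (v u : V) : Prop :=
  ∃ φ : V → V, Set.BijOn φ (ball act S v R) (ball act S u R) ∧ φ v = u ∧
    ∀ x ∈ ball act S v R, ∀ y ∈ ball act S v R, ∀ s : S,
      (act x (s : G) = y ↔ act (φ x) (s : G) = φ y)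

/-- `δ_Γ(R)`: the number of isomorphism classes of rooted balls `(B_v(R), v)`. -/
def ballTypes (act : V → G → V) (S : Set G) (R : ℕ) : ℕ :=
  Nat.card (Quot (BallIso act S R))

/-- `γ_Γ(R)`: the maximal number of vertices of a ball of radius `R` in `Γ`. -/
def graphGrowth (act : V → G → V) (S : Set G) (R : ℕ) : ℕ :=
  ⨆ v : V, Nat.card (ball act S v R)

/-- Isomorphism of the elements `(B_v(R_w(v)), v, v·w)` and `(B_u(R_w(u)), u, u·w)`
of the standard portrait of `w`: a bijection of the balls matching both roots and
preserving the labeled edges. -/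
def PortraitRel (act : V → G → V) (S : Set G) (w : List S) (v u : V) : Prop :=
  ∃ φ : V → V,
    Set.BijOn φ (ball act S v (rad act S w v)) (ball act S u (rad act S w u)) ∧
    φ v = u ∧ φ (act v (wordProd S w)) = act u (wordProd S w) ∧
    ∀ x ∈ ball act S v (rad act S w v), ∀ y ∈ ball act S v (rad act S w v), ∀ s : S,
      (act x (s : G) = y ↔ act (φ x) (s : G) = φ y)

/-- `#P_w`: the number of elements (isomorphism classes of bi-rooted balls)
of the standard portrait of the word `w`. -/
def portraitCard (act : V → G → V) (S : Set G) (w : List S) : ℕ :=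
  Nat.card (Quot (PortraitRel act S w))

/-- The ball of radius `R` in the group `G` with respect to `S`:
elements of word length at most `R`. -/
def ballG (S : Set G) (R : ℕ) : Set G :=
  {g | ∃ w : List S, w.length ≤ R ∧ wordProd S w = g}

/-- `γ_G(R)`: the growth function of `G` with respect to `S`. -/
def groupGrowth (S : Set G) (R : ℕ) : ℕ := Nat.card (ballG S R)

/-- `L(g)`: the minimal size of a standard portrait `P_w` among words `w`
representing `g`. -/
def Lg (act : V → G → V) (S : Set G) (g : G) : ℕ :=
  sInf {m | ∃ w : List S, wordProd S w = g ∧ portraitCard act S w = m}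

/-- `L(R)`: the maximum of `L(g)` over elements with `|g| ≤ R`. -/
def LR (act : V → G → V) (S : Set G) (R : ℕ) : ℕ :=
  ⨆ g : ballG S R, Lg act S (g : G)

/-- `N_p(w)^p = Σ_{(B,x,y) ∈ P_w} (#B)^{p-1}`, the sum over the isomorphism
classes of the standard portrait of `w`. -/
def Npow (act : V → G → V) (S : Set G) (w : List S) (p : ℝ) : ℝ :=
  ∑' q : Quot (PortraitRel act S w),
    (Nat.card (ball act S (Quot.out q) (rad act S w (Quot.out q))) : ℝ) ^ (p - 1)

/-- `N_p(w) = (Σ_{(B,x,y) ∈ P_w} (#B)^{p-1})^{1/p}`. -/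
def Np (act : V → G → V) (S : Set G) (w : List S) (p : ℝ) : ℝ :=
  Npow act S w p ^ (1 / p)

/-- `N_p(g)`: the infimum of `N_p(w)` over words `w` representing `g`. -/
def Npg (act : V → G → V) (S : Set G) (g : G) (p : ℝ) : ℝ :=
  sInf {x : ℝ | ∃ w : List S, wordProd S w = g ∧ Np act S w p = x}

/-- `N_p(R)`: the maximum of `N_p(g)` over elements of length at most `R`. -/
def NpR (act : V → G → V) (S : Set G) (R : ℕ) (p : ℝ) : ℝ :=
  sSup {x : ℝ | ∃ g ∈ ballG S R, Npg act S g p = x}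


/-- An isomorphic embedding of the labeled ball `B_v(R)` into the labeled ball
`B_{v'}(R')`. -/
def IsBallEmbedding (act : V → G → V) (S : Set G) (v v' : V) (R R' : ℕ) (ψ : V → V) : Prop :=
  Set.InjOn ψ (ball act S v R) ∧
  Set.MapsTo ψ (ball act S v R) (ball act S v' R') ∧
  ∀ x ∈ ball act S v R, ∀ y ∈ ball act S v R, ∀ s : S,
    (act x (s : G) = y ↔ act (ψ x) (s : G) = ψ y)


section

variable {act : V → G → V} {S : Set G}

lemma wordProd_append_singleton (w : List S) (s : S) :
    wordProd S (w ++ [s]) = wordProd S w * s := by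
  simp [wordProd]

lemma act_wordProd_mem_ball (v : V) (w : List S) {n : ℕ} (h : w.length ≤ n) :
    act v (wordProd S w) ∈ ball act S v n := ⟨w, h, rfl⟩

lemma ball_mono (v : V) {m n : ℕ} (h : m ≤ n) : ball act S v m ⊆ ball act S v n :=
  fun _ ⟨w, hw, e⟩ => ⟨w, hw.trans h, e⟩

lemma gdist_le {v x : V} {n : ℕ} (h : x ∈ ball act S v n) : gdist act S v x ≤ n :=
  Nat.sInf_le h

lemma mem_ball_gdist {v x : V} {n : ℕ} (h : x ∈ ball act S v n) :
    x ∈ ball act S v (gdist act S v x) :=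
  Nat.sInf_mem (s := {n | x ∈ ball act S v n}) ⟨n, h⟩

lemma gdist_take_le_rad (w : List S) (v : V) {i : ℕ} (hi : i ≤ w.length) :
    gdist act S v (act v (wordProd S (w.take i))) ≤ rad act S w v :=
  Finset.le_sup (f := fun i => gdist act S v (act v (wordProd S (w.take i))))
    (Finset.mem_range.2 (Nat.lt_succ_of_le hi))

lemma take_mem_ball_rad (w : List S) (v : V) {i : ℕ} (hi : i ≤ w.length) :
    act v (wordProd S (w.take i)) ∈ ball act S v (rad act S w v) :=
  ball_mono v (gdist_take_le_rad w v hi) (mem_ball_gdist (act_wordProd_mem_ball v _ le_rfl))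

lemma rad_le_length (w : List S) (v : V) : rad act S w v ≤ w.length :=
  Finset.sup_le fun i _ => gdist_le (act_wordProd_mem_ball v _ (List.length_take_le' i w))

/-- A map preserving the labeled edges of a ball commutes with paths staying in the ball. -/
lemma map_act_wordProd (hact_one : ∀ v : V, act v 1 = v)
    (hact_mul : ∀ (v : V) (g h : G), act (act v g) h = act v (g * h))
    {v : V} {R : ℕ} {ψ : V → V}
    (hedge : ∀ x ∈ ball act S v R, ∀ y ∈ ball act S v R, ∀ s : S,
      (act x (s : G) = y ↔ act (ψ x) (s : G) = ψ y))
    (w : List S)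
    (hw : ∀ i ≤ w.length, act v (wordProd S (w.take i)) ∈ ball act S v R) :
    ψ (act v (wordProd S w)) = act (ψ v) (wordProd S w) := by
  induction w using List.reverseRecOn with
  | nil => simp [wordProd, hact_one]
  | append_singleton w s ih =>
    have hw' : ∀ i ≤ w.length, act v (wordProd S (w.take i)) ∈ ball act S v R := by
      intro i hi
      have := hw i (by simp; omega)
      rwa [List.take_append_of_le_length hi] at this
    have h1 := hw' w.length le_rfl
    have h2 := hw (w ++ [s]).length le_rfl
    rw [List.take_length] at h1 h2
    rw [wordProd_append_singleton, ← hact_mul] at h2 ⊢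
    rw [← hact_mul, ← ih hw']
    exact ((hedge _ h1 _ h2 s).1 rfl).symm

/-- An embedding of a ball of radius at least `R_w(v)` identifies the elements of the
portrait of `w` at `v` and at the image of `v`. -/
lemma IsBallEmbedding.portraitRel (hact_one : ∀ v : V, act v 1 = v)
    (hact_mul : ∀ (v : V) (g h : G), act (act v g) h = act v (g * h))
    {v v' : V} {R R' : ℕ} {ψ : V → V} (hψ : IsBallEmbedding act S v v' R R' ψ)
    {w : List S} (hw : rad act S w v ≤ R) : PortraitRel act S w v (ψ v) := by
  obtain ⟨hinj, -, hedge⟩ := hψ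
  have hshort : ∀ u : List S, u.length ≤ R →
      ψ (act v (wordProd S u)) = act (ψ v) (wordProd S u) := fun u hu =>
    map_act_wordProd hact_one hact_mul hedge u fun i _ =>
      act_wordProd_mem_ball v _ ((List.length_take_le' i u).trans hu)
  have hball : ∀ n ≤ R, ∀ x ∈ ball act S v R,
      (x ∈ ball act S v n ↔ ψ x ∈ ball act S (ψ v) n) := by
    intro n hn x hx
    constructor
    · rintro ⟨u, hu, rfl⟩
      exact ⟨u, hu, (hshort u (hu.trans hn)).symm⟩
    · rintro ⟨u, hu, e⟩
      rw [← hshort u (hu.trans hn)] at e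
      exact ⟨u, hu, hinj (act_wordProd_mem_ball v u (hu.trans hn)) hx e⟩
  have hdist : ∀ x ∈ ball act S v R, gdist act S (ψ v) (ψ x) = gdist act S v x := by
    intro x hx
    have hx' := (hball R le_rfl x hx).1 hx
    apply le_antisymm
    · exact gdist_le ((hball _ (gdist_le hx) x hx).1 (mem_ball_gdist hx))
    · exact gdist_le ((hball _ (gdist_le hx') x hx).2 (mem_ball_gdist hx'))
  have htake : ∀ i ≤ w.length, act v (wordProd S (w.take i)) ∈ ball act S v R :=
    fun i hi => ball_mono v hw (take_mem_ball_rad w v hi)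
  have hpath : ∀ i ≤ w.length,
      ψ (act v (wordProd S (w.take i))) = act (ψ v) (wordProd S (w.take i)) := by
    intro i hi
    refine map_act_wordProd hact_one hact_mul hedge _ fun j hj => ?_
    rw [List.take_take]
    exact htake _ (min_le_of_right_le hi)
  have hrad : rad act S w (ψ v) = rad act S w v := by
    refine Finset.sup_congr rfl fun i hi => ?_
    have hi' : i ≤ w.length := Nat.lt_succ_iff.1 (Finset.mem_range.1 hi)
    rw [← hpath i hi', hdist _ (htake i hi')]
  have hsub := ball_mono (act := act) (S := S) v hw
  refine ⟨ψ, ⟨?_, hinj.mono hsub, ?_⟩, rfl, ?_,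
    fun x hx y hy s => hedge x (hsub hx) y (hsub hy) s⟩
  · intro x hx
    rw [hrad]
    exact (hball _ hw x (hsub hx)).1 hx
  · rw [hrad]
    rintro _ ⟨u, hu, rfl⟩
    exact ⟨_, act_wordProd_mem_ball v u hu, hshort u (hu.trans hw)⟩
  · simpa using hpath w.length le_rfl

/-- The elements of the portrait of radius at most `R` are all represented in a single
ball in which every ball of radius `R` embeds. -/
lemma setOf_rad_le_subset_image (hact_one : ∀ v : V, act v 1 = v)
    (hact_mul : ∀ (v : V) (g h : G), act (act v g) h = act v (g * h))
    {v' : V} {R R' : ℕ} (hrep : ∀ v, ∃ ψ : V → V, IsBallEmbedding act S v v' R R' ψ)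
    (w : List S) :
    {q : Quot (PortraitRel act S w) | rad act S w q.out ≤ R} ⊆
      Quot.mk _ '' ball act S v' R' := by
  intro q hq
  obtain ⟨ψ, hψ⟩ := hrep q.out
  refine ⟨ψ q.out, hψ.2.1 ⟨[], Nat.zero_le _, by simp [wordProd, hact_one]⟩, ?_⟩
  rw [← Quot.sound (hψ.portraitRel hact_one hact_mul hq), Quot.out_eq]

lemma Np_rpow_eq_Npow (w : List S) {p : ℝ} (hp : 1 ≤ p) : Np act S w p ^ p = Npow act S w p := by
  have h0 : 0 ≤ Npow act S w p := tsum_nonneg fun q => by positivity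
  rw [Np, ← Real.rpow_mul h0, one_div_mul_cancel (by positivity), Real.rpow_one]

end

/-- Under conditions (1) and (2) on `Γ`, there exists a constant
`C₁` depending only on `Γ` such that for every word `w ∈ S*`, all exponents
`1 ≤ p₁ < p₂` and every real `V > 0`:
`N_{p₁}(w)^{p₁} ≤ C₁·V^{p₁} + V^{p₁−p₂}·N_{p₂}(w)^{p₂}`. -/
theorem Np_truncation_inequality
    (S : Set G) (hSfin : S.Finite) (hSsym : ∀ s ∈ S, s⁻¹ ∈ S)
    (hSgen : Subgroup.closure S = ⊤)
    (act : V → G → V)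
    (hact_one : ∀ v : V, act v 1 = v)
    (hact_mul : ∀ (v : V) (g h : G), act (act v g) h = act v (g * h))
    (hfaithful : ∀ g : G, (∀ v : V, act v g = v) → g = 1)
    (htrans : ∀ u v : V, ∃ g : G, act u g = v)
    -- condition (1): polynomial growth of the balls
    (C d : ℝ) (hC : 1 ≤ C) (hd : 1 ≤ d)
    (hball : ∀ (v : V) (R : ℕ), 1 ≤ R →
      C⁻¹ * (R : ℝ) ^ d ≤ (Nat.card (ball act S v R) : ℝ) ∧
      (Nat.card (ball act S v R) : ℝ) ≤ C * (R : ℝ) ^ d)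
    -- condition (2): linear repetitivity
    (L : ℝ) (hL : 1 < L)
    (hrep : ∀ (v v' : V) (R : ℕ), 0 < R → ∃ ψ : V → V,
      IsBallEmbedding act S v v' R ⌊L * (R : ℝ)⌋₊ ψ)
    :
    ∃ C₁ : ℝ, 0 < C₁ ∧ ∀ (w : List S) (p₁ p₂ Vr : ℝ), 1 ≤ p₁ → p₁ < p₂ → 0 < Vr →
      Np act S w p₁ ^ p₁ ≤ C₁ * Vr ^ p₁ + Vr ^ (p₁ - p₂) * Np act S w p₂ ^ p₂ := by
  have hC0 : 0 < C := one_pos.trans_le hC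
  have hL0 : 0 < L := one_pos.trans hL
  have hd0 : 0 < d := one_pos.trans_le hd
  have hfin : ∀ (v : V) (R : ℕ), (ball act S v R).Finite := by
    intro v R
    have h : 0 < (Nat.card (ball act S v (R + 1)) : ℝ) :=
      lt_of_lt_of_le (by positivity) (hball v (R + 1) (by omega)).1
    have := Nat.finite_of_card_ne_zero (Nat.cast_pos.1 h).ne'
    exact (Set.toFinite (ball act S v (R + 1))).subset (ball_mono v (by omega))
  refine ⟨C ^ 2 * L ^ d, by positivity, fun w p₁ p₂ Vr hp₁ hp₂ hV => ?_⟩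
  rw [Np_rpow_eq_Npow w hp₁, Np_rpow_eq_Npow w (hp₁.trans hp₂.le)]
  rcases isEmpty_or_nonempty V with hempty | ⟨⟨v'⟩⟩
  · have : IsEmpty (Quot (PortraitRel act S w)) := ⟨fun q => hempty.elim q.out⟩
    simp only [Npow, tsum_empty]
    positivity
  have hsub : ∀ R : ℕ, 0 < R → _ := fun R hR =>
    setOf_rad_le_subset_image hact_one hact_mul (fun v => hrep v v' R hR) w
  have hQ : Finite (Quot (PortraitRel act S w)) := by
    rw [← Set.finite_univ_iff]
    refine ((hfin v' _).image _).subset (subset_trans ?_ (hsub (w.length + 1) (by omega)))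
    exact fun q _ => (rad_le_length w _).trans (Nat.le_succ _)
  have : Fintype (Quot (PortraitRel act S w)) := Fintype.ofFinite _
  simp only [Npow, tsum_fintype]
  set n : Quot (PortraitRel act S w) → ℝ :=
    fun q => (Nat.card (ball act S q.out (rad act S w q.out)) : ℝ)
  have hn1 : ∀ q, 1 ≤ n q := by
    intro q
    have : Nonempty (ball act S q.out (rad act S w q.out)) :=
      ⟨⟨_, [], Nat.zero_le _, rfl⟩⟩
    have := (hfin q.out (rad act S w q.out)).to_subtype
    have hpos : 1 ≤ Nat.card (ball act S q.out (rad act S w q.out)) := Nat.card_pos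
    exact Nat.one_le_cast.2 hpos
  have hcount : ((Finset.univ.filter fun q => n q ≤ Vr).card : ℝ) ≤ C ^ 2 * L ^ d * Vr := by
    rcases lt_or_ge Vr 1 with hV1 | hV1
    · rw [Finset.filter_false_of_mem fun q _ => not_le.2 (hV1.trans_le (hn1 q))]
      simp only [Finset.card_empty, Nat.cast_zero]
      positivity
    have hCV : 1 ≤ C * Vr := one_le_mul_of_one_le_of_one_le hC hV1
    set R : ℕ := ⌊(C * Vr) ^ d⁻¹⌋₊
    have hR1 : 1 ≤ R := Nat.le_floor (by simpa using Real.one_le_rpow hCV (by positivity))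
    have hRd : (R : ℝ) ^ d ≤ C * Vr := by
      calc (R : ℝ) ^ d ≤ ((C * Vr) ^ d⁻¹) ^ d := by
            gcongr
            exact Nat.floor_le (by positivity)
        _ = C * Vr := Real.rpow_inv_rpow (by positivity) hd0.ne'
    have hrad : ∀ q, n q ≤ Vr → rad act S w q.out ≤ R := by
      intro q hq
      rcases Nat.eq_zero_or_pos (rad act S w q.out) with h0 | h0
      · omega
      refine Nat.le_floor ((Real.le_rpow_inv_iff_of_pos (by positivity) (by positivity) hd0).2 ?_)
      have := (hball q.out _ h0).1.trans hq
      rwa [inv_mul_le_iff₀ hC0] at this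
    have hLR : (1 : ℝ) ≤ L * R := one_le_mul_of_one_le_of_one_le hL.le (by exact_mod_cast hR1)
    have hcard : (Finset.univ.filter fun q => n q ≤ Vr).card ≤
        Nat.card (ball act S v' ⌊L * (R : ℝ)⌋₊) := by
      rw [← Set.ncard_coe_finset, Nat.card_coe_set_eq]
      have hle : (↑(Finset.univ.filter fun q => n q ≤ Vr) : Set (Quot (PortraitRel act S w))) ⊆
          Quot.mk _ '' ball act S v' ⌊L * (R : ℝ)⌋₊ :=
        subset_trans (fun q hq => hrad q (by simpa using hq)) (hsub R hR1)
      exact (Set.ncard_le_ncard hle ((hfin v' _).image _)).trans (Set.ncard_image_le (hfin v' _))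
    calc ((Finset.univ.filter fun q => n q ≤ Vr).card : ℝ)
        ≤ (Nat.card (ball act S v' ⌊L * (R : ℝ)⌋₊) : ℝ) := by exact_mod_cast hcard
      _ ≤ C * (⌊L * (R : ℝ)⌋₊ : ℝ) ^ d :=
          (hball v' _ (Nat.le_floor (by simpa using hLR))).2
      _ ≤ C * (L * R) ^ d := by
          gcongr
          exact Nat.floor_le (by positivity)
      _ = C * (L ^ d * (R : ℝ) ^ d) := by rw [Real.mul_rpow hL0.le (by positivity)]
      _ ≤ C * (L ^ d * (C * Vr)) := by gcongr
      _ = C ^ 2 * L ^ d * Vr := by ring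
  have hterm : ∀ q, n q ^ (p₁ - 1) ≤
      (if n q ≤ Vr then Vr ^ (p₁ - 1) else 0) + Vr ^ (p₁ - p₂) * n q ^ (p₂ - 1) := by
    intro q
    have hq : 0 < n q := one_pos.trans_le (hn1 q)
    split_ifs with h
    · have := Real.rpow_le_rpow hq.le h (sub_nonneg.2 hp₁)
      have : 0 ≤ Vr ^ (p₁ - p₂) * n q ^ (p₂ - 1) := by positivity
      linarith
    · rw [zero_add]
      calc n q ^ (p₁ - 1) = n q ^ (p₁ - p₂) * n q ^ (p₂ - 1) := by
            rw [← Real.rpow_add hq]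
            ring_nf
        _ ≤ Vr ^ (p₁ - p₂) * n q ^ (p₂ - 1) := by
            gcongr ?_ * _
            exact Real.rpow_le_rpow_of_nonpos hV (not_le.1 h).le (by linarith)
  calc ∑ q, n q ^ (p₁ - 1)
      ≤ ∑ q, ((if n q ≤ Vr then Vr ^ (p₁ - 1) else 0) + Vr ^ (p₁ - p₂) * n q ^ (p₂ - 1)) :=
        Finset.sum_le_sum fun q _ => hterm q
    _ = ((Finset.univ.filter fun q => n q ≤ Vr).card : ℝ) * Vr ^ (p₁ - 1) +
          Vr ^ (p₁ - p₂) * ∑ q, n q ^ (p₂ - 1) := by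
        rw [Finset.sum_add_distrib, ← Finset.sum_filter, Finset.sum_const, nsmul_eq_mul,
          Finset.mul_sum]
    _ ≤ C ^ 2 * L ^ d * Vr * Vr ^ (p₁ - 1) + Vr ^ (p₁ - p₂) * ∑ q, n q ^ (p₂ - 1) := by
        gcongr
    _ = C ^ 2 * L ^ d * Vr ^ p₁ + Vr ^ (p₁ - p₂) * ∑ q, n q ^ (p₂ - 1) := by
        rw [mul_assoc (C ^ 2 * L ^ d), ← Real.rpow_one_add' hV.le (by linarith),
          add_sub_cancel]

end ActionGrowth
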